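/- arXiv:2308.15737 — 2 statements merged into one kernel-verified Lean document; each statement's English description precedes it below -/
import Mathlib

section
/- Every suitably connected 3-mosaic contains at most one tile that is a crossing tile (T9, T10), a marked-vertex tile (T11, T12), or a singular-vertex tile (T13, T14), and if such a tile occurs then it is located at the center position (2,2) of the board. -/
/-- The 15 mosaic tiles. -/
inductive Tile where
  | T0 | T1 | T2 | T3 | T4 | T5 | T6 | T7 | T8 | T9 | T10 | T11 | T12 | T13 | T14
  deriving DecidableEq

instance : Fintype Tile where
  elems := ⟨([.T0, .T1, .T2, .T3, .T4, .T5, .T6, .T7, .T8, .T9, .T10, .T11, .T12, .T13, .T14] :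
    List Tile), by decide⟩
  complete := by intro x; cases x <;> decide

namespace Tile

/-- Whether a tile has a connection point on its top edge. -/
def top : Tile → Bool
  | T3 | T4 | T6 | T7 | T8 | T9 | T10 | T11 | T12 | T13 | T14 => true
  | _ => false

/-- Whether a tile has a connection point on its bottom edge. -/
def bottom : Tile → Bool
  | T1 | T2 | T6 | T7 | T8 | T9 | T10 | T11 | T12 | T13 | T14 => true
  | _ => false

/-- Whether a tile has a connection point on its left edge. -/
def left : Tile → Bool
  | T1 | T4 | T5 | T7 | T8 | T9 | T10 | T11 | T12 | T13 | T14 => true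
  | _ => false

/-- Whether a tile has a connection point on its right edge. -/
def right : Tile → Bool
  | T2 | T3 | T5 | T7 | T8 | T9 | T10 | T11 | T12 | T13 | T14 => true
  | _ => false

end Tile

/-- An (m,n)-mosaic (rows indexed by `Fin m`, columns by `Fin n`) is suitably connected if
every connection point of every tile coincides with a connection point of a contiguous tile. -/
def SuitablyConnected {m n : ℕ} (M : Fin m → Fin n → Tile) : Prop :=
  ∀ (i : Fin m) (j : Fin n),
    ((M i j).top = true → ∃ i' : Fin m, i'.val + 1 = i.val ∧ (M i' j).bottom = true) ∧
    ((M i j).bottom = true → ∃ i' : Fin m, i.val + 1 = i'.val ∧ (M i' j).top = true) ∧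
    ((M i j).left = true → ∃ j' : Fin n, j'.val + 1 = j.val ∧ (M i j').right = true) ∧
    ((M i j).right = true → ∃ j' : Fin n, j.val + 1 = j'.val ∧ (M i j').left = true)

/-- Every suitably connected 3-mosaic contains at most one tile among the crossing
tiles (T9, T10), marked-vertex tiles (T11, T12), and singular-vertex tiles (T13, T14); and if
such a tile occurs then it is located at the center position (2,2) of the board. -/
theorem three_mosaic_decorated_tile_center (M : Fin 3 → Fin 3 → Tile)
    (h : SuitablyConnected M) :
    (Finset.univ.filter (fun p : Fin 3 × Fin 3 =>
        M p.1 p.2 ∈ ([Tile.T9, Tile.T10, Tile.T11, Tile.T12, Tile.T13, Tile.T14] : List Tile))).card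
      ≤ 1 ∧
    ∀ i j : Fin 3,
      M i j ∈ ([Tile.T9, Tile.T10, Tile.T11, Tile.T12, Tile.T13, Tile.T14] : List Tile) →
      i = (1 : Fin 3) ∧ j = (1 : Fin 3) := by
  have key : ∀ i j : Fin 3,
      M i j ∈ ([Tile.T9, Tile.T10, Tile.T11, Tile.T12, Tile.T13, Tile.T14] : List Tile) →
      i = (1 : Fin 3) ∧ j = (1 : Fin 3) := by
    intro i j hm
    have all : ∀ t : Tile,
        t ∈ ([Tile.T9, Tile.T10, Tile.T11, Tile.T12, Tile.T13, Tile.T14] : List Tile) →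
        t.top = true ∧ t.bottom = true ∧ t.left = true ∧ t.right = true := by decide
    obtain ⟨ht, hb, hl, hr⟩ := all _ hm
    obtain ⟨h1, h2, h3, h4⟩ := h i j
    obtain ⟨a, ha, -⟩ := h1 ht
    obtain ⟨b, hbb, -⟩ := h2 hb
    obtain ⟨c, hc, -⟩ := h3 hl
    obtain ⟨d, hd, -⟩ := h4 hr
    constructor <;> apply Fin.ext <;> simp <;> omega
  refine ⟨?_, key⟩
  rw [Finset.card_le_one]
  intro p hp q hq
  simp only [Finset.mem_filter, Finset.mem_univ, true_and] at hp hq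
  have h1 := key _ _ hp
  have h2 := key _ _ hq
  exact Prod.ext (h1.1.trans h2.1.symm) (h1.2.trans h2.2.symm)
end

section
/- There are exactly four suitably connected 3-mosaics that contain a singular-vertex tile (T13 or T14): in each of them the singular-vertex tile is at the center position (2,2), and the eight boundary tiles connect the four connection points of the center tile in one of exactly two possible ways (pairing top with right and bottom with left, or pairing top with left and bottom with right), for each of the two choices T13, T14 of the center tile. -/
/-- The horizontal and vertical matching conditions of a suitably connected 3-mosaic. -/
theorem sc_match {M : Fin 3 → Fin 3 → Tile} (h : SuitablyConnected M) :
    (∀ j, (M 0 j).top = false ∧ (M 2 j).bottom = false ∧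
      (M 0 j).bottom = (M 1 j).top ∧ (M 1 j).bottom = (M 2 j).top) ∧
    (∀ i, (M i 0).left = false ∧ (M i 2).right = false ∧
      (M i 0).right = (M i 1).left ∧ (M i 1).right = (M i 2).left) := by
  constructor
  · intro j
    have h0 := h 0 j
    have h1 := h 1 j
    have h2 := h 2 j
    simp [Fin.exists_fin_succ] at h0 h1 h2
    refine ⟨h0.1, h2.2.1, ?_, ?_⟩
    · exact Bool.eq_iff_iff.2 ⟨h0.2.1, h1.1⟩
    · exact Bool.eq_iff_iff.2 ⟨h1.2.1, h2.1⟩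
  · intro j
    have h0 := h j 0
    have h1 := h j 1
    have h2 := h j 2
    simp [Fin.exists_fin_succ] at h0 h1 h2
    refine ⟨h0.2.2.1, h2.2.2.2, ?_, ?_⟩
    · exact Bool.eq_iff_iff.2 ⟨h0.2.2.2, h1.2.2.1⟩
    · exact Bool.eq_iff_iff.2 ⟨h1.2.2.2, h2.2.2.1⟩

theorem corner_tl : ∀ t : Tile, t.top = false → t.left = false → t = .T0 ∨ t = .T2 := by decide
theorem corner_tr : ∀ t : Tile, t.top = false → t.right = false → t = .T0 ∨ t = .T1 := by decide
theorem corner_bl : ∀ t : Tile, t.bottom = false → t.left = false → t = .T0 ∨ t = .T3 := by decide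
theorem corner_br : ∀ t : Tile, t.bottom = false → t.right = false → t = .T0 ∨ t = .T4 := by decide
theorem side_t : ∀ t : Tile, t.top = false → t.bottom = true → t = .T1 ∨ t = .T2 := by decide
theorem side_b : ∀ t : Tile, t.bottom = false → t.top = true → t = .T3 ∨ t = .T4 := by decide
theorem side_l : ∀ t : Tile, t.left = false → t.right = true → t = .T2 ∨ t = .T3 := by decide
theorem side_r : ∀ t : Tile, t.right = false → t.left = true → t = .T1 ∨ t = .T4 := by decide

theorem sing_all : ∀ t : Tile, t = .T13 ∨ t = .T14 →
    t.top = true ∧ t.bottom = true ∧ t.left = true ∧ t.right = true := by decide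

theorem sing_center {M : Fin 3 → Fin 3 → Tile} (h : SuitablyConnected M)
    {i j : Fin 3} (hs : M i j = .T13 ∨ M i j = .T14) : M 1 1 = .T13 ∨ M 1 1 = .T14 := by
  obtain ⟨hv, hh⟩ := sc_match h
  have ha := sing_all _ hs
  have hi : i = 1 := by
    have h1 := hv j
    fin_cases i
    · simp_all
    · rfl
    · simp_all
  have hj : j = 1 := by
    have h1 := hh i
    fin_cases j
    · simp_all
    · rfl
    · simp_all
  subst hi hj
  exact hs

theorem mosaic_eq (M : Fin 3 → Fin 3 → Tile) :
    M = ![![M 0 0, M 0 1, M 0 2], ![M 1 0, M 1 1, M 1 2], ![M 2 0, M 2 1, M 2 2]] := by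
  funext i j
  fin_cases i <;> fin_cases j <;> rfl

instance {m n : ℕ} (M : Fin m → Fin n → Tile) : Decidable (SuitablyConnected M) := by
  unfold SuitablyConnected
  infer_instance

/-- There are exactly four suitably connected 3-mosaics containing a
singular-vertex tile (T13 or T14): in each the singular-vertex tile sits at the center
position (2,2), and the eight boundary tiles connect the four connection points of the
center tile in one of exactly two ways (top with right and bottom with left, or top with
left and bottom with right), for each of the two center tiles T13, T14. -/
theorem three_mosaics_with_singular_vertex :
    {M : Fin 3 → Fin 3 → Tile |
        SuitablyConnected M ∧ ∃ i j : Fin 3, M i j = Tile.T13 ∨ M i j = Tile.T14} =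
      ({![![Tile.T0, Tile.T2, Tile.T1],
          ![Tile.T2, Tile.T13, Tile.T4],
          ![Tile.T3, Tile.T4, Tile.T0]],
        ![![Tile.T0, Tile.T2, Tile.T1],
          ![Tile.T2, Tile.T14, Tile.T4],
          ![Tile.T3, Tile.T4, Tile.T0]],
        ![![Tile.T2, Tile.T1, Tile.T0],
          ![Tile.T3, Tile.T13, Tile.T1],
          ![Tile.T0, Tile.T3, Tile.T4]],
        ![![Tile.T2, Tile.T1, Tile.T0],
          ![Tile.T3, Tile.T14, Tile.T1],
          ![Tile.T0, Tile.T3, Tile.T4]]} : Set (Fin 3 → Fin 3 → Tile)) ∧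
    ({M : Fin 3 → Fin 3 → Tile |
        SuitablyConnected M ∧ ∃ i j : Fin 3, M i j = Tile.T13 ∨ M i j = Tile.T14}).ncard = 4 := by
  refine (fun {a b : Prop} (ha : a) (hb : a → b) => And.intro ha (hb ha)) ?_ (fun h => ?_)
  swap
  · rw [h, Set.ncard_eq_toFinset_card']
    decide
  ext M
  simp only [Set.mem_setOf_eq, Set.mem_insert_iff, Set.mem_singleton_iff]
  constructor
  · rintro ⟨h, i, j, hs⟩
    have hc := sing_center h hs
    obtain ⟨hv, hh⟩ := sc_match h
    obtain ⟨ct, cb, cl, cr⟩ := sing_all _ hc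
    obtain ⟨a1, a2, a3, a4⟩ := hv 0
    obtain ⟨b1, b2, b3, b4⟩ := hv 1
    obtain ⟨c1, c2, c3, c4⟩ := hv 2
    obtain ⟨d1, d2, d3, d4⟩ := hh 0
    obtain ⟨e1, e2, e3, e4⟩ := hh 1
    obtain ⟨f1, f2, f3, f4⟩ := hh 2
    have st := side_t _ b1 (b3.trans ct)
    have sb := side_b _ b2 (b4.symm.trans cb)
    have sl := side_l _ e1 (e3.trans cl)
    have sr := side_r _ e2 (e4.symm.trans cr)
    have k1 := corner_tl _ a1 d1
    have k2 := corner_tr _ c1 d2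
    have k3 := corner_bl _ a2 f1
    have k4 := corner_br _ c2 f2
    clear hv hh h hs
    rw [mosaic_eq M]
    generalize M 0 0 = x00 at *
    generalize M 0 1 = x01 at *
    generalize M 0 2 = x02 at *
    generalize M 1 0 = x10 at *
    generalize M 1 1 = x11 at *
    generalize M 1 2 = x12 at *
    generalize M 2 0 = x20 at *
    generalize M 2 1 = x21 at *
    generalize M 2 2 = x22 at *
    clear M
    rcases st with rfl | rfl <;> rcases k1 with rfl | rfl <;> cases d3 <;>
      rcases k2 with rfl | rfl <;> cases d4 <;>
      rcases sl with rfl | rfl <;> cases a3 <;>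
      rcases sr with rfl | rfl <;> cases c3 <;>
      rcases k3 with rfl | rfl <;> cases a4 <;>
      rcases sb with rfl | rfl <;> cases f3 <;>
      rcases k4 with rfl | rfl <;> cases f4 <;> cases c4 <;>
      rcases hc with rfl | rfl <;> simp
  · rintro (rfl | rfl | rfl | rfl)
    all_goals exact ⟨by decide, 1, 1, by decide⟩
end
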